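/- Let Γ and Γ' be connected primitively log divergent simple graphs on disjoint vertex sets, each with at least one edge, and let uv ∈ E(Γ) and u'v' ∈ E(Γ'). Then the gluing Γ×Γ' of Γ and Γ' along the edges uv and u'v' is again primitively log divergent. -/

import Mathlib

/-- The first Betti number `h₁(G) = |E(G)| − |V(G)| + c(G)` of a finite simple graph. -/
noncomputable def betti {V : Type*} (G : SimpleGraph V) : ℤ :=
  (Nat.card G.edgeSet : ℤ) - (Nat.card V : ℤ) + (Nat.card G.ConnectedComponent : ℤ)

/-- The set of endpoints of the edges in `F`. -/
def edgeSupport {V : Type*} (F : Set (Sym2 V)) : Set V := {v : V | ∃ e ∈ F, v ∈ e}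

/-- The subgraph spanned by a set of edges `F`: its edge set is `F` and its vertex set
is the set of endpoints of edges in `F`. -/
def spannedSubgraph {V : Type*} (F : Set (Sym2 V)) : SimpleGraph (edgeSupport F) :=
  (SimpleGraph.fromEdgeSet F).induce (edgeSupport F)

/-- `h₁(G_F) = |F| − |V(G_F)| + c(G_F)` for the subgraph spanned by `F`. -/
noncomputable def bettiOfEdges {V : Type*} (F : Set (Sym2 V)) : ℤ :=
  (Nat.card F : ℤ) - (Nat.card (edgeSupport F) : ℤ)
    + (Nat.card (spannedSubgraph F).ConnectedComponent : ℤ)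

/-- The subgraph spanned by `F` is convergent: `|E| > 2·h₁`. -/
def ConvergentEdges {V : Type*} (F : Set (Sym2 V)) : Prop :=
  2 * bettiOfEdges F < (Nat.card F : ℤ)

/-- A graph is logarithmically divergent if `|E(G)| = 2·h₁(G)`. -/
def LogDivergent {V : Type*} (G : SimpleGraph V) : Prop :=
  (Nat.card G.edgeSet : ℤ) = 2 * betti G

/-- A graph is primitively log divergent if it is logarithmically divergent and the
subgraph spanned by every nonempty proper subset of its edges which is connected is
convergent. -/
def PrimLogDivergent {V : Type*} (G : SimpleGraph V) : Prop :=
  LogDivergent G ∧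
    ∀ F : Set (Sym2 V), F ⊆ G.edgeSet → F.Nonempty → F ≠ G.edgeSet →
      (spannedSubgraph F).Connected → ConvergentEdges F

/-- The vertex identification map used in the gluing construction: `u' ↦ u`, `v' ↦ v`,
and every other vertex of `Γ'` is kept (as an element of the right summand). -/
def glueMap {V V' : Type*} [DecidableEq V'] (u v : V) (u' v' : V') (x : V') :
    V ⊕ {y : V' // y ≠ u' ∧ y ≠ v'} :=
  if h1 : x = u' then Sum.inl u
  else if h2 : x = v' then Sum.inl v
  else Sum.inr ⟨x, h1, h2⟩

/-- The gluing `Γ × Γ'` of two simple graphs (on disjoint vertex sets) along the edges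
`uv` and `u'v'`: delete the edge `uv` from `Γ` and the edge `u'v'` from `Γ'`, take the
disjoint union, and identify `u` with `u'` and `v` with `v'`. -/
def glue {V V' : Type*} [DecidableEq V'] (G : SimpleGraph V) (G' : SimpleGraph V')
    (u v : V) (u' v' : V') : SimpleGraph (V ⊕ {y : V' // y ≠ u' ∧ y ≠ v'}) :=
  SimpleGraph.fromEdgeSet
    ((Sym2.map Sum.inl '' (G.edgeSet \ {s(u, v)})) ∪
     (Sym2.map (glueMap u v u' v') '' (G'.edgeSet \ {s(u', v')})))

theorem edgeSupport_empty {V : Type*} : edgeSupport (∅ : Set (Sym2 V)) = ∅ := by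
  ext x
  simp [edgeSupport]

theorem edgeSupport_union {V : Type*} (A B : Set (Sym2 V)) :
    edgeSupport (A ∪ B) = edgeSupport A ∪ edgeSupport B := by
  ext x
  simp only [edgeSupport, Set.mem_ofPred_eq, Set.mem_union]
  grind

theorem edgeSupport_image {V W : Type*} (f : V → W) (F : Set (Sym2 V)) :
    edgeSupport (Sym2.map f '' F) = f '' edgeSupport F := by
  ext x
  simp only [edgeSupport, Set.mem_ofPred_eq, Set.mem_image]
  constructor
  · rintro ⟨_, ⟨e, he, rfl⟩, hx⟩
    obtain ⟨a, ha, rfl⟩ := Sym2.mem_map.1 hx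
    exact ⟨a, ⟨e, he, ha⟩, rfl⟩
  · rintro ⟨a, ⟨e, he, ha⟩, rfl⟩
    exact ⟨_, ⟨e, he, rfl⟩, Sym2.mem_map.2 ⟨a, ha, rfl⟩⟩

theorem disjoint_of_disjoint_edgeSupport {V : Type*} {A B : Set (Sym2 V)}
    (h : Disjoint (edgeSupport A) (edgeSupport B)) : Disjoint A B := by
  rw [Set.disjoint_left] at h ⊢
  intro e hA hB
  induction e with
  | _ a b => exact h (a := a) ⟨_, hA, by simp⟩ ⟨_, hB, by simp⟩

theorem card_connectedComponent_eq_one {V : Type*} {G : SimpleGraph V} (h : G.Connected) :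
    Nat.card G.ConnectedComponent = 1 := by
  rw [Nat.card_eq_one_iff_unique]
  have := h.nonempty
  exact ⟨h.preconnected.subsingleton_connectedComponent, inferInstance⟩

theorem convergentEdges_iff {V : Type*} {F : Set (Sym2 V)}
    (h : (spannedSubgraph F).Connected) :
    ConvergentEdges F ↔ F.ncard + 3 ≤ 2 * (edgeSupport F).ncard := by
  unfold ConvergentEdges bettiOfEdges
  rw [card_connectedComponent_eq_one h, Nat.card_coe_set_eq, Nat.card_coe_set_eq]
  omega

theorem logDivergent_iff {V : Type*} {G : SimpleGraph V} (h : G.Connected) :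
    LogDivergent G ↔ G.edgeSet.ncard + 2 = 2 * Nat.card V := by
  unfold LogDivergent betti
  rw [card_connectedComponent_eq_one h, Nat.card_coe_set_eq]
  omega

theorem exists_split_of_not_connected {V : Type*} {F : Set (Sym2 V)} (hF : F.Nonempty)
    (h : ¬ (spannedSubgraph F).Connected) :
    ∃ A B : Set (Sym2 V), A.Nonempty ∧ B.Nonempty ∧ A ∪ B = F ∧
      Disjoint (edgeSupport A) (edgeSupport B) := by
  have hne : Nonempty (edgeSupport F) := by
    obtain ⟨e, he⟩ := hF
    induction e with
    | _ a b => exact ⟨⟨a, _, he, by simp⟩⟩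
  have hpre : ¬ (spannedSubgraph F).Preconnected := fun hp => h ⟨hp⟩
  simp only [SimpleGraph.Preconnected, not_forall] at hpre
  obtain ⟨⟨a, ea, hea, ha⟩, ⟨b, eb, heb, hb⟩, hab⟩ := hpre
  set a' : edgeSupport F := ⟨a, ea, hea, ha⟩ with ha'
  let S : Set V := {x | ∃ hx : x ∈ edgeSupport F, (spannedSubgraph F).Reachable a' ⟨x, hx⟩}
  have hS : ∀ e ∈ F, ∀ x ∈ e, ∀ y ∈ e, x ∈ S → y ∈ S := by
    rintro e he x hx y hy ⟨hxF, hr⟩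
    refine ⟨⟨e, he, hy⟩, ?_⟩
    by_cases hxy : x = y
    · subst hxy; exact hr
    · refine hr.trans (SimpleGraph.Adj.reachable ?_)
      have : e = s(x, y) := (Sym2.mem_and_mem_iff hxy).1 ⟨hx, hy⟩
      subst this
      simp [spannedSubgraph, he, hxy]
  refine ⟨{e ∈ F | ∀ x ∈ e, x ∈ S}, {e ∈ F | ¬ ∀ x ∈ e, x ∈ S},
    ⟨ea, hea, fun x hx => hS ea hea a ha x hx ⟨⟨ea, hea, ha⟩, SimpleGraph.Reachable.refl _⟩⟩,
    ⟨eb, heb, fun hall => hab (hall b hb).2⟩, ?_, ?_⟩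
  · ext e
    simp only [Set.mem_union, Set.mem_ofPred_eq]
    tauto
  · rw [Set.disjoint_left]
    rintro x ⟨e, ⟨he, hall⟩, hx⟩ ⟨e', ⟨he', hall'⟩, hx'⟩
    exact hall' fun y hy => hS e' he' x hx' y hy (hall x hx)

/-- In a primitively log divergent graph the bound `|F| + 3 ≤ 2 |V(F)|` holds for all nonempty
proper edge sets, connected or not. -/
theorem PrimLogDivergent.ncard_add_three_le {V : Type*} [Finite V] {G : SimpleGraph V}
    (hG : PrimLogDivergent G) {F : Set (Sym2 V)} (hF : F ⊆ G.edgeSet) (hne : F.Nonempty)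
    (hpr : F ≠ G.edgeSet) : F.ncard + 3 ≤ 2 * (edgeSupport F).ncard := by
  induction hn : F.ncard using Nat.strong_induction_on generalizing F with
  | _ n ih =>
    subst hn
    by_cases hc : (spannedSubgraph F).Connected
    · exact (convergentEdges_iff hc).1 (hG.2 F hF hne hpr hc)
    · obtain ⟨A, B, hA, hB, rfl, hd⟩ := exists_split_of_not_connected hne hc
      have hdAB := disjoint_of_disjoint_edgeSupport hd
      have hcard := Set.ncard_union_eq hdAB
      have hcard' := Set.ncard_union_eq hd
      have hA0 := (Set.ncard_pos).2 hA
      have hB0 := (Set.ncard_pos).2 hB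
      have hAE := Set.subset_union_left.trans hF
      have hBE := Set.subset_union_right.trans hF
      have hA' : A ≠ G.edgeSet := by
        rintro rfl
        obtain ⟨e, he⟩ := hB
        exact Set.disjoint_left.1 hdAB (hBE he) he
      have hB' : B ≠ G.edgeSet := by
        rintro rfl
        obtain ⟨e, he⟩ := hA
        exact Set.disjoint_left.1 hdAB he (hAE he)
      have h1 := ih _ (by omega) hAE hA hA' rfl
      have h2 := ih _ (by omega) hBE hB hB' rfl
      rw [edgeSupport_union]
      omega

theorem PrimLogDivergent.ncard_add_two_le {V : Type*} [Finite V] {G : SimpleGraph V}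
    (hG : PrimLogDivergent G) {F : Set (Sym2 V)} (hF : F ⊆ G.edgeSet)
    (hpr : F ≠ G.edgeSet) {S : Set V} (hS : S.Nonempty) (hFS : edgeSupport F ⊆ S) :
    F.ncard + 2 ≤ 2 * S.ncard := by
  have h1 := (Set.ncard_pos).2 hS
  have h2 := Set.ncard_le_ncard hFS
  rcases F.eq_empty_or_nonempty with rfl | hne
  · simp only [Set.ncard_empty]
    omega
  · have := hG.ncard_add_three_le hF hne hpr
    omega

theorem PrimLogDivergent.deleteEdges_connected {V : Type*} [Finite V] {G : SimpleGraph V}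
    (hG : PrimLogDivergent G) (hc : G.Connected) {u v : V} (he : s(u, v) ∈ G.edgeSet) :
    (G.deleteEdges {s(u, v)}).Connected := by
  refine hc.connected_delete_edge_of_not_isBridge ?_
  rw [SimpleGraph.isBridge_iff]
  intro hr
  let S : Set V := {x | (G.deleteEdges {s(u, v)}).Reachable u x}
  have hu : u ∈ S := SimpleGraph.Reachable.refl _
  have hv : v ∉ S := hr
  have hS : ∀ x y, G.Adj x y → s(x, y) ≠ s(u, v) → x ∈ S → y ∈ S := by
    intro x y hxy hne hx
    exact SimpleGraph.Reachable.trans hx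
      (SimpleGraph.Adj.reachable (by simpa [SimpleGraph.deleteEdges_adj, hxy] using hne))
  have hcover : G.edgeSet ⊆
      insert s(u, v) ({e ∈ G.edgeSet | ∀ x ∈ e, x ∈ S} ∪ {e ∈ G.edgeSet | ∀ x ∈ e, x ∈ Sᶜ}) := by
    intro e hE
    induction e with
    | _ x y =>
      by_cases hne : s(x, y) = s(u, v)
      · exact Or.inl hne
      · have h1 := hS x y hE hne
        have h2 := hS y x (SimpleGraph.Adj.symm hE) (by rwa [Sym2.eq_swap])
        by_cases hx : x ∈ S
        · exact Or.inr (Or.inl ⟨hE, by simpa using ⟨hx, h1 hx⟩⟩)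
        · exact Or.inr (Or.inr ⟨hE, by simpa using ⟨hx, fun hy => hx (h2 hy)⟩⟩)
  have h1 := Set.ncard_le_ncard hcover
  have h2 := h1.trans (Set.ncard_insert_le _ _)
  have h3 := Set.ncard_union_le {e ∈ G.edgeSet | ∀ x ∈ e, x ∈ S}
    {e ∈ G.edgeSet | ∀ x ∈ e, x ∈ Sᶜ}
  have hA := hG.ncard_add_two_le (F := {e ∈ G.edgeSet | ∀ x ∈ e, x ∈ S}) (Set.sep_subset _ _)
    (fun h => hv ((h.symm ▸ he : s(u, v) ∈ {e ∈ G.edgeSet | ∀ x ∈ e, x ∈ S}).2 v (by simp)))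
    ⟨u, hu⟩ (by rintro x ⟨e, ⟨-, h⟩, hx⟩; exact h x hx)
  have hB := hG.ncard_add_two_le (F := {e ∈ G.edgeSet | ∀ x ∈ e, x ∈ Sᶜ}) (Set.sep_subset _ _)
    (fun h => (h.symm ▸ he : s(u, v) ∈ {e ∈ G.edgeSet | ∀ x ∈ e, x ∈ Sᶜ}).2 u (by simp) hu)
    ⟨v, hv⟩ (by rintro x ⟨e, ⟨-, h⟩, hx⟩; exact h x hx)
  have h4 := Set.ncard_add_ncard_compl S
  have h5 := (logDivergent_iff hc).1 hG.1
  omega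

theorem card_glue_vertices {V V' : Type*} [Finite V] [Finite V'] {u' v' : V'}
    (h' : u' ≠ v') :
    Nat.card (V ⊕ {y : V' // y ≠ u' ∧ y ≠ v'}) + 2 = Nat.card V + Nat.card V' := by
  have h1 : {y : V' | y ≠ u' ∧ y ≠ v'} = ({u', v'} : Set V')ᶜ := by
    ext y
    simp
  have h2 := Set.ncard_add_ncard_compl ({u', v'} : Set V')
  rw [Set.ncard_pair h', ← h1] at h2
  have h3 : Nat.card {y : V' // y ≠ u' ∧ y ≠ v'} = {y : V' | y ≠ u' ∧ y ≠ v'}.ncard := rfl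
  rw [Nat.card_sum, h3]
  omega

section Glue

variable {V V' : Type*} [DecidableEq V'] (G : SimpleGraph V) (G' : SimpleGraph V')
  {u v : V} {u' v' : V'}

@[simp]
theorem glueMap_left : glueMap u v u' v' u' = Sum.inl u := by simp [glueMap]

theorem glueMap_injective (h : u ≠ v) : Function.Injective (glueMap u v u' v') := by
  intro x y hxy
  unfold glueMap at hxy
  grind

theorem glueMap_eq_inl {x : V'} {a : V} (h : glueMap u v u' v' x = Sum.inl a) :
    a = u ∧ x = u' ∨ a = v ∧ x = v' := by
  unfold glueMap at h
  grind

theorem glue_edgeSet (h : u ≠ v) :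
    (glue G G' u v u' v').edgeSet =
      (Sym2.map Sum.inl '' (G.edgeSet \ {s(u, v)})) ∪
      (Sym2.map (glueMap u v u' v') '' (G'.edgeSet \ {s(u', v')})) := by
  rw [glue, SimpleGraph.edgeSet_fromEdgeSet, sdiff_eq_left, Set.disjoint_left]
  rintro _ (⟨e, ⟨he, -⟩, rfl⟩ | ⟨e, ⟨he, -⟩, rfl⟩) hd
  · exact G.not_isDiag_of_mem_edgeSet he ((Sym2.isDiag_map Sum.inl_injective).1 hd)
  · exact G'.not_isDiag_of_mem_edgeSet he ((Sym2.isDiag_map (glueMap_injective h)).1 hd)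

theorem disjoint_glue_edges :
    Disjoint
      (Sym2.map Sum.inl '' (G.edgeSet \ {s(u, v)}))
      (Sym2.map (glueMap u v u' v') '' (G'.edgeSet \ {s(u', v')})) := by
  rw [Set.disjoint_left]
  rintro _ ⟨e, ⟨he, hne⟩, rfl⟩ ⟨e', ⟨he', hne'⟩, heq⟩
  induction e with
  | _ a b =>
  induction e' with
  | _ x y =>
    have hab : a ≠ b := G.ne_of_adj he
    simp only [Sym2.map_mk, Sym2.eq_iff] at heq
    simp only [Set.mem_singleton_iff, Sym2.eq_iff] at hne
    rcases heq with ⟨h1, h2⟩ | ⟨h1, h2⟩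
    · have h1 := glueMap_eq_inl h1
      have h2 := glueMap_eq_inl h2
      grind
    · have h1 := glueMap_eq_inl h1
      have h2 := glueMap_eq_inl h2
      grind

theorem glue_connected (h : u ≠ v)
    (hG : (G.deleteEdges {s(u, v)}).Connected)
    (hG' : (G'.deleteEdges {s(u', v')}).Connected) :
    (glue G G' u v u' v').Connected := by
  let f : G.deleteEdges {s(u, v)} →g glue G G' u v u' v' :=
    { toFun := Sum.inl
      map_rel' := by
        intro a b hab
        rw [SimpleGraph.deleteEdges_adj] at hab
        rw [← SimpleGraph.mem_edgeSet, glue_edgeSet G G' h]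
        exact Or.inl ⟨s(a, b), hab, rfl⟩ }
  let g : G'.deleteEdges {s(u', v')} →g glue G G' u v u' v' :=
    { toFun := glueMap u v u' v'
      map_rel' := by
        intro a b hab
        rw [SimpleGraph.deleteEdges_adj] at hab
        rw [← SimpleGraph.mem_edgeSet, glue_edgeSet G G' h]
        exact Or.inr ⟨s(a, b), hab, rfl⟩ }
  rw [SimpleGraph.connected_iff_exists_forall_reachable]
  refine ⟨Sum.inl u, ?_⟩
  rintro (a | ⟨y, hy⟩)
  · exact (hG.preconnected u a).map f
  · have hr := (hG'.preconnected u' y).map g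
    simpa [g, glueMap, hy.1, hy.2] using hr

theorem ncard_glue_edgeSet_add_two [Finite V] [Finite V'] (he : s(u, v) ∈ G.edgeSet)
    (he' : s(u', v') ∈ G'.edgeSet) :
    (glue G G' u v u' v').edgeSet.ncard + 2 = G.edgeSet.ncard + G'.edgeSet.ncard := by
  have h : u ≠ v := G.ne_of_adj he
  rw [glue_edgeSet G G' h, Set.ncard_union_eq (disjoint_glue_edges G G'),
    Set.ncard_image_of_injective _ (Sym2.map.injective Sum.inl_injective),
    Set.ncard_image_of_injective _ (Sym2.map.injective (glueMap_injective h))]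
  have h1 := Set.ncard_sdiff_singleton_add_one he
  have h2 := Set.ncard_sdiff_singleton_add_one he'
  omega

end Glue

theorem edgeSupport_insert_of_mem {V : Type*} {F : Set (Sym2 V)} {u v : V}
    (hu : u ∈ edgeSupport F) (hv : v ∈ edgeSupport F) :
    edgeSupport (insert s(u, v) F) = edgeSupport F := by
  ext x
  constructor
  · rintro ⟨e, rfl | he, hx⟩
    · rcases Sym2.mem_iff.1 hx with rfl | rfl <;> assumption
    · exact ⟨e, he, hx⟩
  · rintro ⟨e, he, hx⟩
    exact ⟨e, Or.inr he, hx⟩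

theorem PrimLogDivergent.ncard_add_four_le {V : Type*} [Finite V] {G : SimpleGraph V}
    (hG : PrimLogDivergent G) {u v : V} (he : s(u, v) ∈ G.edgeSet) {F : Set (Sym2 V)}
    (hF : F ⊆ G.edgeSet \ {s(u, v)}) (hpr : F ≠ G.edgeSet \ {s(u, v)})
    (hu : u ∈ edgeSupport F) (hv : v ∈ edgeSupport F) :
    F.ncard + 4 ≤ 2 * (edgeSupport F).ncard := by
  have hnot : s(u, v) ∉ F := fun h => (hF h).2 rfl
  have h1 := hG.ncard_add_three_le (F := insert s(u, v) F)
    (Set.insert_subset he (hF.trans Set.sdiff_subset)) (Set.insert_nonempty _ _)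
    (fun h => hpr (by rw [← h, Set.insert_sdiff_self_of_notMem hnot]))
  rw [edgeSupport_insert_of_mem hu hv, Set.ncard_insert_of_notMem hnot] at h1
  omega

/-- Theorem 3.2.3: the gluing `Γ × Γ'` of two connected primitively log divergent
simple graphs along edges `uv ∈ E(Γ)` and `u'v' ∈ E(Γ')` is again primitively log
divergent. -/
theorem glue_primLogDivergent {V V' : Type*} [Fintype V] [Fintype V'] [DecidableEq V']
    (G : SimpleGraph V) (G' : SimpleGraph V')
    (hG : G.Connected) (hG' : G'.Connected)
    (u v : V) (u' v' : V')
    (he : s(u, v) ∈ G.edgeSet) (he' : s(u', v') ∈ G'.edgeSet)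
    (hpld : PrimLogDivergent G) (hpld' : PrimLogDivergent G') :
    PrimLogDivergent (glue G G' u v u' v') := by
  have h : u ≠ v := G.ne_of_adj he
  have h' : u' ≠ v' := G'.ne_of_adj he'
  constructor
  · rw [logDivergent_iff (glue_connected G G' h (hpld.deleteEdges_connected hG he)
      (hpld'.deleteEdges_connected hG' he'))]
    have h1 := (logDivergent_iff hG).1 hpld.1
    have h2 := (logDivergent_iff hG').1 hpld'.1
    have h3 := ncard_glue_edgeSet_add_two G G' he he'
    have h4 := card_glue_vertices (V := V) h'
    omega
  intro F hF hne hpr hc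
  rw [convergentEdges_iff hc]
  rw [glue_edgeSet G G' h] at hF hpr
  obtain ⟨A, hA, B, hB, rfl⟩ : ∃ A ⊆ G.edgeSet \ {s(u, v)}, ∃ B ⊆ G'.edgeSet \ {s(u', v')},
      F = Sym2.map Sum.inl '' A ∪ Sym2.map (glueMap u v u' v') '' B := by
    refine ⟨(G.edgeSet \ {s(u, v)}) ∩ Sym2.map Sum.inl ⁻¹' F, Set.inter_subset_left,
      (G'.edgeSet \ {s(u', v')}) ∩ Sym2.map (glueMap u v u' v') ⁻¹' F,
      Set.inter_subset_left, ?_⟩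
    rw [Set.image_inter_preimage, Set.image_inter_preimage, ← Set.union_inter_distrib_right,
      Set.inter_eq_right.2 hF]
  have hcard : (Sym2.map Sum.inl '' A ∪ Sym2.map (glueMap u v u' v') '' B).ncard
      ≤ A.ncard + B.ncard :=
    (Set.ncard_union_le _ _).trans (add_le_add (Set.ncard_image_le) (Set.ncard_image_le))
  rw [edgeSupport_union, edgeSupport_image, edgeSupport_image]
  have hsupp := Set.ncard_union_add_ncard_inter (Sum.inl '' edgeSupport A)
    (glueMap u v u' v' '' edgeSupport B)
  rw [Set.ncard_image_of_injective _ Sum.inl_injective,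
    Set.ncard_image_of_injective _ (glueMap_injective h)] at hsupp
  have hApr : A ≠ G.edgeSet := fun hh => (hA (hh ▸ he)).2 rfl
  have hBpr : B ≠ G'.edgeSet := fun hh => (hB (hh ▸ he')).2 rfl
  have hAG := hA.trans Set.sdiff_subset
  have hBG := hB.trans Set.sdiff_subset
  rcases A.eq_empty_or_nonempty with rfl | hA0
  · have hB0 : B.Nonempty := by simpa using hne
    have := hpld'.ncard_add_three_le hBG hB0 hBpr
    simp only [edgeSupport_empty, Set.image_empty, Set.empty_inter, Set.ncard_empty]
      at hsupp hcard ⊢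
    omega
  rcases B.eq_empty_or_nonempty with rfl | hB0
  · have := hpld.ncard_add_three_le hAG hA0 hApr
    simp only [edgeSupport_empty, Set.image_empty, Set.inter_empty, Set.ncard_empty]
      at hsupp hcard ⊢
    omega
  have h1 := hpld.ncard_add_three_le hAG hA0 hApr
  have h2 := hpld'.ncard_add_three_le hBG hB0 hBpr
  by_cases hall : (u ∈ edgeSupport A ∧ u' ∈ edgeSupport B) ∧
      (v ∈ edgeSupport A ∧ v' ∈ edgeSupport B)
  · obtain ⟨⟨hu, hu'⟩, hv, hv'⟩ := hall
    have hI : (Sum.inl '' edgeSupport A ∩ glueMap u v u' v' '' edgeSupport B).ncard ≤ 2 := by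
      refine (Set.ncard_le_ncard (t := {Sum.inl u, Sum.inl v}) ?_).trans (Set.ncard_pair (by simpa using h)).le
      rintro _ ⟨⟨a, ha, rfl⟩, ⟨x, hx, hxa⟩⟩
      rcases glueMap_eq_inl hxa with ⟨rfl, -⟩ | ⟨rfl, -⟩ <;> simp
    by_cases hAe : A = G.edgeSet \ {s(u, v)}
    · have hBe : B ≠ G'.edgeSet \ {s(u', v')} := fun hBe => hpr (by rw [hAe, hBe])
      have := hpld'.ncard_add_four_le he' hB hBe hu' hv'
      omega
    · have := hpld.ncard_add_four_le he hA hAe hu hv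
      omega
  · have hI : (Sum.inl '' edgeSupport A ∩ glueMap u v u' v' '' edgeSupport B).ncard ≤ 1 := by
      rw [Set.ncard_le_one]
      rintro _ ⟨⟨a, ha, rfl⟩, ⟨x, hx, hxa⟩⟩ _ ⟨⟨b, hb, rfl⟩, ⟨y, hy, hyb⟩⟩
      have h1 := glueMap_eq_inl hxa
      have h2 := glueMap_eq_inl hyb
      grind
    omega
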